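/- For all integers n ≥ 0 and α ≥ 0, p̄_o(2^{2α}(24n+15)) ≡ 0 (mod 3). -/

import Mathlib

/-- Number of overpartitions of `n` into odd parts: pairs consisting of a
partition of some `m ≤ n` into distinct odd parts (the overlined parts)
and a partition of `n - m` into odd parts. -/
def pbarOdd (n : ℕ) : ℕ :=
  ∑ m ∈ Finset.range (n + 1),
    (Nat.Partition.oddDistincts m).card * (Nat.Partition.odds (n - m)).card

section GaussBinomial

variable {R : Type*} [CommRing R]

/-- The Gaussian binomial coefficient `[m; k]` with base `t`. -/
def gaussBinom (t : R) : ℕ → ℕ → R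
  | _, 0 => 1
  | 0, _ + 1 => 0
  | m + 1, k + 1 => gaussBinom t m k + t ^ (k + 1) * gaussBinom t m (k + 1)

@[simp]
theorem gaussBinom_zero_right (t : R) (m : ℕ) : gaussBinom t m 0 = 1 := by
  cases m <;> rfl

theorem gaussBinom_succ_succ (t : R) (m k : ℕ) :
    gaussBinom t (m + 1) (k + 1) = gaussBinom t m k + t ^ (k + 1) * gaussBinom t m (k + 1) :=
  rfl

theorem gaussBinom_eq_zero_of_lt (t : R) {m k : ℕ} (h : m < k) : gaussBinom t m k = 0 := by
  induction m generalizing k with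
  | zero => obtain ⟨k, rfl⟩ := Nat.exists_eq_succ_of_ne_zero h.ne'; rfl
  | succ m ih =>
    obtain ⟨k, rfl⟩ := Nat.exists_eq_succ_of_ne_zero (Nat.ne_zero_of_lt h)
    rw [gaussBinom_succ_succ, ih (by lia), ih (by lia)]
    ring

theorem gaussBinom_succ_succ' (t : R) {m k : ℕ} (h : k ≤ m) :
    gaussBinom t (m + 1) (k + 1) = gaussBinom t m (k + 1) + t ^ (m - k) * gaussBinom t m k := by
  induction m generalizing k with
  | zero =>
    obtain rfl : k = 0 := by lia
    simp [gaussBinom]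
  | succ m ih =>
    rcases k with _ | k
    · have h1 := ih (Nat.zero_le m)
      have h2 := gaussBinom_succ_succ t m 0
      rw [gaussBinom_succ_succ t (m + 1) 0]
      simp only [gaussBinom_zero_right, Nat.sub_zero] at h1 h2 ⊢
      linear_combination t * h1 - h2
    · rcases (Nat.succ_le_succ_iff.mp h).eq_or_lt with rfl | hk
      · rw [gaussBinom_succ_succ, gaussBinom_eq_zero_of_lt t (by lia : k + 1 < k + 1 + 1)]
        simp
      · obtain ⟨d, rfl⟩ := Nat.exists_eq_add_of_lt hk
        have h1 := ih (by lia : k ≤ k + d + 1)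
        have h2 := ih (by lia : k + 1 ≤ k + d + 1)
        rw [show k + d + 1 - k = d + 1 by lia] at h1
        rw [show k + d + 1 - (k + 1) = d by lia] at h2
        rw [gaussBinom_succ_succ t (k + d + 1 + 1) (k + 1),
          show k + d + 1 + 1 - (k + 1) = d + 1 by lia]
        linear_combination h1 + t ^ (k + 2) * h2 -
          gaussBinom_succ_succ t (k + d + 1) (k + 1) -
          t ^ (d + 1) * gaussBinom_succ_succ t (k + d + 1) k

theorem gaussBinom_mul_prod_mul_prod (t : R) (a b : ℕ) :
    gaussBinom t (a + b) a * (∏ i ∈ Finset.range a, (1 - t ^ (i + 1))) *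
      (∏ i ∈ Finset.range b, (1 - t ^ (i + 1))) =
    ∏ i ∈ Finset.range (a + b), (1 - t ^ (i + 1)) := by
  induction hm : a + b generalizing a b with
  | zero =>
    obtain ⟨rfl, rfl⟩ : a = 0 ∧ b = 0 := by lia
    simp
  | succ m ih =>
    rcases a with _ | a
    · obtain rfl : b = m + 1 := by lia
      simp
    rcases b with _ | b
    · obtain rfl : a = m := by lia
      have := ih a 0 rfl
      simp only [Finset.range_zero, Finset.prod_empty, mul_one] at this ⊢
      rw [gaussBinom_succ_succ, gaussBinom_eq_zero_of_lt t (Nat.lt_succ_self a),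
        Finset.prod_range_succ]
      linear_combination (1 - t ^ (a + 1)) * this
    · have h1 := ih a (b + 1) (by lia)
      have h2 := ih (a + 1) b (by lia)
      rw [gaussBinom_succ_succ, Finset.prod_range_succ _ m, show m = a + b + 1 by lia]
      rw [show m = a + b + 1 by lia] at h1 h2
      rw [Finset.prod_range_succ _ b] at h1 ⊢
      rw [Finset.prod_range_succ _ a] at h2 ⊢
      linear_combination (1 - t ^ (a + 1)) * h1 + t ^ (a + 1) * (1 - t ^ (b + 1)) * h2

theorem prod_mul_prod_eq_sum_gaussBinom (x : R) (a b : ℕ) :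
    (∏ i ∈ Finset.range a, (1 + x ^ (2 * i + 1))) * (∏ i ∈ Finset.range b, (1 + x ^ (2 * i + 1))) =
    ∑ k ∈ Finset.range (a + b + 1),
      x ^ ((k : ℤ) - a).natAbs ^ 2 * gaussBinom (x ^ 2) (a + b) k := by
  induction b with
  | zero =>
    induction a with
    | zero => simp
    | succ a ih =>
      simp only [Finset.range_zero, Finset.prod_empty, mul_one, add_zero] at ih ⊢
      rw [Finset.prod_range_succ, ih, mul_add, mul_one, Finset.sum_range_succ' _ (a + 1)]
      simp only [gaussBinom_succ_succ, mul_add, Finset.sum_add_distrib, gaussBinom_zero_right]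
      rw [add_assoc]
      congr 1
      · simp
      rw [Finset.sum_range_succ', Finset.sum_range_succ _ a,
        gaussBinom_eq_zero_of_lt _ (Nat.lt_succ_self a), add_mul, Finset.sum_mul]
      simp only [mul_zero, add_zero]
      congr 1
      · refine Finset.sum_congr rfl fun k _ => ?_
        rw [← pow_mul, ← mul_assoc, ← pow_add, mul_right_comm, ← pow_add]
        congr 2
        zify
        simp only [sq_abs]
        ring
      · simp only [gaussBinom_zero_right, mul_one, ← pow_add]
        congr 1
        zify
        simp only [sq_abs]
        ring
  | succ b ih =>
    rw [Finset.prod_range_succ, ← mul_assoc, ih, mul_add, mul_one, Finset.sum_mul, ← add_assoc a,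
      Finset.sum_range_succ' _ (a + b + 1)]
    have key : ∀ k ∈ Finset.range (a + b + 1),
        x ^ (((k + 1 : ℕ) : ℤ) - a).natAbs ^ 2 * gaussBinom (x ^ 2) (a + b + 1) (k + 1) =
        x ^ (((k + 1 : ℕ) : ℤ) - a).natAbs ^ 2 * gaussBinom (x ^ 2) (a + b) (k + 1) +
        x ^ ((k : ℤ) - a).natAbs ^ 2 * gaussBinom (x ^ 2) (a + b) k * x ^ (2 * b + 1) := by
      intro k hk
      have hk : k ≤ a + b := by simpa [Nat.lt_succ_iff] using hk
      rw [gaussBinom_succ_succ' _ hk, mul_add, ← pow_mul, ← mul_assoc, ← pow_add, mul_right_comm,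
        ← pow_add]
      congr 3
      zify [hk]
      simp only [sq_abs]
      ring
    rw [Finset.sum_congr rfl key, Finset.sum_add_distrib, add_right_comm (∑ _ ∈ _, _)]
    congr 1
    rw [Finset.sum_range_succ' _ (a + b), Finset.sum_range_succ _ (a + b),
      gaussBinom_eq_zero_of_lt _ (Nat.lt_succ_self (a + b))]
    simp

theorem prod_range_one_sub_pow_of_pow_eq_zero {x : R} {M n : ℕ} (hx : x ^ M = 0) (hn : M ≤ n) :
    ∏ i ∈ Finset.range n, (1 - (x ^ 2) ^ (i + 1)) =
      ∏ i ∈ Finset.range M, (1 - (x ^ 2) ^ (i + 1)) := by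
  refine (Finset.prod_subset (Finset.range_mono hn) fun i _ hi => ?_).symm
  rw [← pow_mul, pow_eq_zero_of_le _ hx, sub_zero]
  simp only [Finset.mem_range, not_lt] at hi
  lia

theorem prod_sq_mul_prod_eq_sum_sq_of_pow_eq_zero (x : R) {M : ℕ} (hx : x ^ M = 0) :
    (∏ i ∈ Finset.range (2 * M), (1 + x ^ (2 * i + 1))) ^ 2 *
      (∏ i ∈ Finset.range (2 * M), (1 - (x ^ 2) ^ (i + 1))) =
    ∑ j ∈ Finset.Icc (-(2 * M) : ℤ) (2 * M), x ^ j.natAbs ^ 2 := by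
  have hpoch := fun n => prod_range_one_sub_pow_of_pow_eq_zero (x := x) hx (n := n)
  have hunit : IsUnit (∏ i ∈ Finset.range M, (1 - (x ^ 2) ^ (i + 1))) := by
    refine IsUnit.prod_iff.mpr fun i _ => IsNilpotent.isUnit_one_sub ⟨M, ?_⟩
    rw [← pow_mul, ← pow_mul]
    exact pow_eq_zero_of_le (by nlinarith [Nat.zero_le (i * M)]) hx
  have hbinom : ∀ k ∈ Finset.range (2 * M + 2 * M + 1),
      x ^ ((k : ℤ) - (2 * M : ℕ)).natAbs ^ 2 * gaussBinom (x ^ 2) (2 * M + 2 * M) k *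
        (∏ i ∈ Finset.range M, (1 - (x ^ 2) ^ (i + 1))) =
      x ^ ((k : ℤ) - (2 * M : ℕ)).natAbs ^ 2 := by
    intro k hk
    rw [Finset.mem_range] at hk
    by_cases h : M ≤ ((k : ℤ) - (2 * M : ℕ)).natAbs
    · rw [pow_eq_zero_of_le (h.trans (Nat.le_self_pow two_ne_zero _)) hx]
      ring
    · have := gaussBinom_mul_prod_mul_prod (x ^ 2) k (2 * M + 2 * M - k)
      rw [hpoch k (by lia), hpoch (2 * M + 2 * M - k) (by lia), Nat.add_sub_cancel' (by lia),
        hpoch (2 * M + 2 * M) (by lia)] at this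
      have := hunit.mul_right_cancel (this.trans (one_mul _).symm)
      rw [mul_assoc, this, mul_one]
  rw [sq, prod_mul_prod_eq_sum_gaussBinom, hpoch _ (by lia), Finset.sum_mul,
    Finset.sum_congr rfl hbinom]
  refine Finset.sum_bij' (fun k _ => (k : ℤ) - (2 * M : ℕ)) (fun j _ => (j + 2 * M).toNat)
    ?_ ?_ ?_ ?_ ?_ <;> intros <;> simp_all <;> lia

end GaussBinomial

section WeightSeries

open PowerSeries

variable {R : Type*} [CommRing R] {ι κ : Type*}

/-- The power series `∑ i, c i * X ^ w i`, for `w` with finite fibres. -/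
noncomputable def weightSeries (w : ι → ℕ) (c : ι → R) : R⟦X⟧ :=
  PowerSeries.mk fun n => ∑ᶠ i ∈ {i | w i = n}, c i

theorem coeff_weightSeries {w : ι → ℕ} (hw : ∀ n, {i | w i = n}.Finite) (c : ι → R) (n : ℕ) :
    coeff n (weightSeries w c) = ∑ i ∈ (hw n).toFinset, c i := by
  rw [weightSeries, coeff_mk, finsum_mem_eq_finite_toFinset_sum]

theorem finite_fibre_add {w : ι → ℕ} {w' : κ → ℕ} (hw : ∀ n, {i | w i = n}.Finite)
    (hw' : ∀ n, {i | w' i = n}.Finite) (n : ℕ) :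
    {p : ι × κ | w p.1 + w' p.2 = n}.Finite := by
  refine ((Set.finite_le_nat n).biUnion fun a _ => (Set.finite_le_nat n).biUnion fun b _ =>
    (hw a).prod (hw' b)).subset fun p hp => ?_
  have hp : w p.1 + w' p.2 = n := hp
  simp only [Set.mem_iUnion]
  exact ⟨w p.1, by simp; lia, w' p.2, by simp; lia, rfl, rfl⟩

theorem weightSeries_mul {w : ι → ℕ} {w' : κ → ℕ} (hw : ∀ n, {i | w i = n}.Finite)
    (hw' : ∀ n, {i | w' i = n}.Finite) (c : ι → R) (c' : κ → R) :
    weightSeries w c * weightSeries w' c' =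
      weightSeries (fun p : ι × κ => w p.1 + w' p.2) (fun p => c p.1 * c' p.2) := by
  classical
  ext n
  rw [coeff_mul, coeff_weightSeries (finite_fibre_add hw hw'),
    ← Finset.sum_fiberwise_of_maps_to (t := Finset.HasAntidiagonal.antidiagonal n)
      (g := fun p : ι × κ => (w p.1, w' p.2)) (by simp)]
  refine Finset.sum_congr rfl fun p hp => ?_
  rw [coeff_weightSeries hw, coeff_weightSeries hw', Finset.sum_mul_sum, ← Finset.sum_product']
  refine Finset.sum_congr ?_ fun _ _ => rfl
  ext v
  rw [Finset.HasAntidiagonal.mem_antidiagonal] at hp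
  simp [Prod.ext_iff]
  lia

theorem expand_weightSeries {w : ι → ℕ} {p : ℕ} (hp : p ≠ 0) (c : ι → R) :
    expand p hp (weightSeries w c) = weightSeries (fun i => p * w i) c := by
  ext n
  rw [coeff_expand]
  split_ifs with h
  · obtain ⟨m, rfl⟩ := h
    simp [weightSeries, Nat.mul_div_cancel_left _ (Nat.pos_of_ne_zero hp), hp]
  · rw [weightSeries, coeff_mk]
    have : {i | p * w i = n} = ∅ := by
      ext i
      simp only [Set.mem_ofPred_eq, Set.mem_empty_iff_false, iff_false]
      rintro rfl
      exact h (dvd_mul_right _ _)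
    simp [this]

theorem X_pow_dvd_weightSeries_sub_sum {w : ι → ℕ} (hw : ∀ n, {i | w i = n}.Finite) (c : ι → R)
    {M : ℕ} (s : Finset ι) (hs : ∀ i ∉ s, M ≤ w i) :
    X ^ M ∣ weightSeries w c - ∑ i ∈ s, C (c i) * X ^ w i := by
  classical
  rw [X_pow_dvd_iff]
  intro m hm
  rw [map_sub, coeff_weightSeries hw, map_sum, sub_eq_zero]
  simp only [coeff_C_mul, coeff_X_pow, mul_ite, mul_one, mul_zero]
  rw [← Finset.sum_filter]
  refine Finset.sum_congr ?_ fun _ _ => rfl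
  ext i
  simp only [Set.Finite.mem_toFinset, Set.mem_ofPred_eq, Finset.mem_filter]
  refine ⟨fun h => ⟨?_, h.symm⟩, fun h => h.2.symm⟩
  by_contra hi
  have := hs i hi
  lia

end WeightSeries

section Partitions

open PowerSeries Nat.Partition PowerSeries.WithPiTopology

theorem X_pow_dvd_sub_prod_of_hasProd {R : Type*} [CommRing R] [TopologicalSpace R] [T2Space R]
    {f : ℕ → R⟦X⟧} {P : R⟦X⟧} (hP : HasProd f P) {M : ℕ} (hf : ∀ i, M ≤ i → X ^ M ∣ f i - 1) :
    X ^ M ∣ P - ∏ i ∈ Finset.range M, f i := by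
  have hdvd : ∀ N, M ≤ N → X ^ M ∣ ∏ i ∈ Finset.range N, f i - ∏ i ∈ Finset.range M, f i := by
    intro N hN
    induction N, hN using Nat.le_induction with
    | base => simp
    | succ N hN ih =>
      have := (dvd_mul_of_dvd_right (hf N hN) (∏ i ∈ Finset.range N, f i)).add ih
      rw [Finset.prod_range_succ]
      convert this using 1
      ring
  rw [X_pow_dvd_iff]
  intro m hm
  rw [map_sub, sub_eq_zero]
  have ht := (WithPiTopology.tendsto_iff_coeff_tendsto R _ _ _).mp hP.tendsto_prod_nat m
  refine tendsto_nhds_unique ht (tendsto_atTop_of_eventually_const (i₀ := M) fun N hN => ?_)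
  rw [← sub_eq_zero, ← map_sub]
  exact X_pow_dvd_iff.mp (hdvd N hN) m hm

theorem prod_ite_even_eq_prod_odd {A : Type*} [CommMonoid A] (f : ℕ → A) (N : ℕ) :
    ∏ i ∈ Finset.range (2 * N), (if ¬ Even (i + 1) then f (i + 1) else 1) =
      ∏ i ∈ Finset.range N, f (2 * i + 1) := by
  induction N with
  | zero => simp
  | succ N ih =>
    rw [show 2 * (N + 1) = 2 * N + 1 + 1 by ring, Finset.prod_range_succ, Finset.prod_range_succ,
      ih, Finset.prod_range_succ, if_pos (by grind), if_neg (by grind), mul_one]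

variable (R : Type*) [CommRing R]

theorem X_pow_dvd_card_oddDistincts_sub_prod (N : ℕ) :
    X ^ (2 * N) ∣ (PowerSeries.mk fun n => ((oddDistincts n).card : R)) -
      ∏ i ∈ Finset.range N, (1 + X ^ (2 * i + 1)) := by
  let _ : TopologicalSpace R := ⊥
  have _ : DiscreteTopology R := ⟨rfl⟩
  have hgen : (PowerSeries.mk fun n => ((oddDistincts n).card : R)) =
      genFun fun i c => if ¬ Even i ∧ c < 2 then (1 : R) else 0 := by
    simp_rw [genFun, oddDistincts, ← countRestricted_two, odds, restricted, countRestricted,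
      ← Finset.filter_and, Finset.card_filter, Finsupp.prod, Finset.prod_boole]
    simp [forall_and]
  have hprod := hasProd_genFun fun i c => if ¬ Even i ∧ c < 2 then (1 : R) else 0
  have hfac : (fun i => (1 : R⟦X⟧) + ∑' j, (if ¬ Even (i + 1) ∧ j + 1 < 2 then (1 : R) else 0) •
      X ^ ((i + 1) * (j + 1))) = fun i => if ¬ Even (i + 1) then 1 + X ^ (i + 1) else 1 := by
    ext1 i
    rw [tsum_eq_single 0 fun j hj => by rw [if_neg (by lia), zero_smul]]
    split_ifs <;> simp_all
  rw [hfac, ← hgen] at hprod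
  rw [← prod_ite_even_eq_prod_odd fun i => (1 : R⟦X⟧) + X ^ i]
  refine X_pow_dvd_sub_prod_of_hasProd hprod fun i hi => ?_
  split_ifs
  · simp
  · simpa using pow_dvd_pow X (by lia)

theorem X_pow_dvd_card_odds_mul_prod_sub_one (N : ℕ) :
    X ^ (2 * N) ∣ (PowerSeries.mk fun n => ((odds n).card : R)) *
      ∏ i ∈ Finset.range N, (1 - X ^ (2 * i + 1)) - 1 := by
  let _ : TopologicalSpace R := ⊥
  have _ : DiscreteTopology R := ⟨rfl⟩
  have hgeom : ∀ i : ℕ, (∑' j : ℕ, (X : R⟦X⟧) ^ ((i + 1) * j)) * (1 - X ^ (i + 1)) = 1 := by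
    intro i
    simp_rw [pow_mul]
    exact tsum_pow_mul_one_sub_of_constantCoeff_eq_zero (by simp)
  have h := X_pow_dvd_sub_prod_of_hasProd (M := 2 * N)
    (hasProd_powerSeriesMk_card_restricted R (¬ Even ·)) fun i hi => by
      split_ifs
      · simp
      · have := dvd_mul_of_dvd_right (pow_dvd_pow (X : R⟦X⟧) (by lia : 2 * N ≤ i + 1))
          (∑' j : ℕ, (X : R⟦X⟧) ^ ((i + 1) * j))
        convert this using 1
        linear_combination hgeom i
  rw [← prod_ite_even_eq_prod_odd fun i => (1 : R⟦X⟧) - X ^ i]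
  have hinv : (∏ i ∈ Finset.range (2 * N),
      if ¬ Even (i + 1) then ∑' j : ℕ, (X : R⟦X⟧) ^ ((i + 1) * j) else 1) *
      (∏ i ∈ Finset.range (2 * N), if ¬ Even (i + 1) then (1 : R⟦X⟧) - X ^ (i + 1) else 1) = 1 := by
    rw [← Finset.prod_mul_distrib]
    refine Finset.prod_eq_one fun i _ => ?_
    split_ifs
    · simp
    · exact hgeom i
  have := dvd_mul_of_dvd_left h
    (∏ i ∈ Finset.range (2 * N), if ¬ Even (i + 1) then (1 : R⟦X⟧) - X ^ (i + 1) else 1)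
  rwa [sub_mul, hinv] at this

theorem mk_pbarOdd_eq_mul :
    (PowerSeries.mk fun n => (pbarOdd n : R)) =
      (PowerSeries.mk fun n => ((oddDistincts n).card : R)) *
        PowerSeries.mk fun n => ((odds n).card : R) := by
  ext n
  rw [coeff_mul, Finset.Nat.sum_antidiagonal_eq_sum_range_succ_mk]
  simp [pbarOdd]

end Partitions

section Theta

open PowerSeries

variable {R : Type*} [CommRing R]

/-- The theta series `∑ j : ℤ, s ^ (j ^ 2) * X ^ (e * j ^ 2)`. -/
noncomputable def thetaSeries (e : ℕ) (s : R) : R⟦X⟧ :=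
  weightSeries (fun j : ℤ => e * j.natAbs ^ 2) fun j => s ^ j.natAbs ^ 2

theorem finite_fibre_mul_natAbs_sq {e : ℕ} (he : e ≠ 0) (n : ℕ) :
    {j : ℤ | e * j.natAbs ^ 2 = n}.Finite := by
  refine (Set.finite_Icc (-(n : ℤ)) n).subset fun j hj => ?_
  have hj : e * j.natAbs ^ 2 = n := hj
  have : j.natAbs ≤ n := hj ▸ (Nat.le_self_pow two_ne_zero _).trans
    (Nat.le_mul_of_pos_left _ (Nat.pos_of_ne_zero he))
  simp only [Set.mem_Icc]
  lia

theorem X_pow_dvd_thetaSeries_sub {e : ℕ} (he : e ≠ 0) (s : R) (M : ℕ) :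
    X ^ M ∣ thetaSeries e s -
      (∏ i ∈ Finset.range (2 * M), (1 + (C s * X ^ e) ^ (2 * i + 1))) ^ 2 *
        ∏ i ∈ Finset.range (2 * M), (1 - ((C s * X ^ e) ^ 2) ^ (i + 1)) := by
  have h1 := X_pow_dvd_weightSeries_sub_sum (finite_fibre_mul_natAbs_sq he)
    (fun j => s ^ j.natAbs ^ 2) (M := M) (Finset.Icc (-(2 * M) : ℤ) (2 * M)) fun j hj => by
      have : M ≤ j.natAbs := by
        rw [Finset.mem_Icc] at hj
        lia
      exact this.trans ((Nat.le_self_pow two_ne_zero _).trans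
        (Nat.le_mul_of_pos_left _ (Nat.pos_of_ne_zero he)))
  rw [← Ideal.mem_span_singleton, ← Ideal.Quotient.eq] at h1 ⊢
  have hx : (Ideal.Quotient.mk (Ideal.span {(X : R⟦X⟧) ^ M}) (C s * X ^ e)) ^ M = 0 := by
    rw [← map_pow, Ideal.Quotient.eq_zero_iff_mem, Ideal.mem_span_singleton, mul_pow, ← pow_mul]
    exact dvd_mul_of_dvd_right (pow_dvd_pow X (Nat.le_mul_of_pos_left _ (Nat.pos_of_ne_zero he))) _
  have h2 := prod_sq_mul_prod_eq_sum_sq_of_pow_eq_zero _ hx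
  rw [thetaSeries, h1]
  simp only [map_mul, map_pow, map_prod, map_add, map_sub, map_one, map_sum] at h2 ⊢
  rw [h2]
  simp only [mul_pow, pow_mul]

theorem expand_thetaSeries {p : ℕ} (hp : p ≠ 0) (e : ℕ) (s : R) :
    expand p hp (thetaSeries e s) = thetaSeries (p * e) s := by
  simp only [thetaSeries, expand_weightSeries, mul_assoc]

theorem thetaSeries_ne_zero [Nontrivial R] {e : ℕ} (he : e ≠ 0) (s : R) : thetaSeries e s ≠ 0 := by
  intro h
  have h0 := congrArg (coeff 0) h
  rw [thetaSeries, coeff_weightSeries (finite_fibre_mul_natAbs_sq he),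
    Finset.sum_eq_single (0 : ℤ)] at h0
  · simp at h0
  · intro j hj hj0
    simp [he, hj0] at hj
  · simp

/-- The product form of `P * φ(-x ^ 2) = φ(x)`, where `P = ∏ (1 + x ^ (2 * i + 1)) * u` and `u` is
the inverse of `∏ (1 - x ^ (2 * i + 1))`. -/
theorem prod_mul_inverse_mul_prod_of_pow_eq_zero {x u : R} {M : ℕ} (hx : x ^ M = 0)
    (hu : u * ∏ i ∈ Finset.range (2 * M), (1 - x ^ (2 * i + 1)) = 1) :
    (∏ i ∈ Finset.range (2 * M), (1 + x ^ (2 * i + 1))) * u *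
      ((∏ i ∈ Finset.range (2 * M), (1 + (-1 * x ^ 2) ^ (2 * i + 1))) ^ 2 *
        ∏ i ∈ Finset.range (2 * M), (1 - ((-1 * x ^ 2) ^ 2) ^ (i + 1))) =
    (∏ i ∈ Finset.range (2 * M), (1 + (1 * x ^ 1) ^ (2 * i + 1))) ^ 2 *
      ∏ i ∈ Finset.range (2 * M), (1 - ((1 * x ^ 1) ^ 2) ^ (i + 1)) := by
  have hdouble : ∀ K : ℕ, (∏ i ∈ Finset.range K, (1 + x ^ (2 * i + 1))) *
      (∏ i ∈ Finset.range K, (1 - x ^ (2 * i + 1))) *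
      (∏ i ∈ Finset.range K, (1 - ((x ^ 2) ^ 2) ^ (i + 1))) =
      ∏ i ∈ Finset.range (2 * K), (1 - (x ^ 2) ^ (i + 1)) := by
    intro K
    induction K with
    | zero => simp
    | succ K ih =>
      rw [show 2 * (K + 1) = 2 * K + 1 + 1 by ring, Finset.prod_range_succ _ (2 * K + 1),
        Finset.prod_range_succ _ (2 * K), ← ih]
      simp only [Finset.prod_range_succ]
      ring
  have hodd : ∏ i ∈ Finset.range (2 * M), (1 + (-1 * x ^ 2) ^ (2 * i + 1)) =
      (∏ i ∈ Finset.range (2 * M), (1 + x ^ (2 * i + 1))) *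
        ∏ i ∈ Finset.range (2 * M), (1 - x ^ (2 * i + 1)) := by
    rw [← Finset.prod_mul_distrib]
    refine Finset.prod_congr rfl fun i _ => ?_
    have hneg : (-1 : R) ^ (2 * i + 1) = -1 :=
      Odd.neg_one_pow ⟨i, rfl⟩
    rw [mul_pow, hneg]
    ring
  have htrunc : ∏ i ∈ Finset.range (2 * (2 * M)), (1 - (x ^ 2) ^ (i + 1)) =
      ∏ i ∈ Finset.range (2 * M), (1 - (x ^ 2) ^ (i + 1)) := by
    rw [prod_range_one_sub_pow_of_pow_eq_zero hx (by lia),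
      prod_range_one_sub_pow_of_pow_eq_zero hx (by lia : M ≤ 2 * M)]
  have hsq : (-1 * x ^ 2) ^ 2 = (x ^ 2) ^ 2 := by ring
  rw [hodd, hsq]
  simp only [pow_one, one_mul]
  rw [← htrunc, ← hdouble (2 * M)]
  linear_combination (∏ i ∈ Finset.range (2 * M), (1 + x ^ (2 * i + 1))) ^ 3 *
    (∏ i ∈ Finset.range (2 * M), (1 - x ^ (2 * i + 1))) *
    (∏ i ∈ Finset.range (2 * M), (1 - ((x ^ 2) ^ 2) ^ (i + 1))) * hu

theorem mk_pbarOdd_mul_thetaSeries :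
    (PowerSeries.mk fun n => (pbarOdd n : R)) * thetaSeries 2 (-1) = thetaSeries 1 1 := by
  suffices h : ∀ M : ℕ, X ^ M ∣
      (PowerSeries.mk fun n => (pbarOdd n : R)) * thetaSeries 2 (-1) - thetaSeries 1 1 by
    ext n
    rw [← sub_eq_zero, ← map_sub]
    exact X_pow_dvd_iff.mp (h (n + 1)) n (Nat.lt_succ_self n)
  intro M
  have hM : (X : R⟦X⟧) ^ M ∣ X ^ (2 * (2 * M)) := pow_dvd_pow X (by lia)
  have hD := hM.trans (X_pow_dvd_card_oddDistincts_sub_prod R (2 * M))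
  have hO := hM.trans (X_pow_dvd_card_odds_mul_prod_sub_one R (2 * M))
  have h1 := X_pow_dvd_thetaSeries_sub one_ne_zero (1 : R) M
  have h2 := X_pow_dvd_thetaSeries_sub two_ne_zero (-1 : R) M
  rw [mk_pbarOdd_eq_mul]
  rw [← Ideal.mem_span_singleton, ← Ideal.Quotient.eq] at hD hO h1 h2 ⊢
  have hx : (Ideal.Quotient.mk (Ideal.span {(X : R⟦X⟧) ^ M}) X) ^ M = 0 := by
    rw [← map_pow, Ideal.Quotient.eq_zero_iff_mem, Ideal.mem_span_singleton]
  simp only [map_mul, map_pow, map_prod, map_add, map_sub, map_one, map_neg] at hD hO h1 h2 ⊢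
  rw [hD, h1, h2]
  exact prod_mul_inverse_mul_prod_of_pow_eq_zero hx hO

end Theta

section ModThree

open PowerSeries

theorem coeff_mul_mul_expand {R : Type*} [CommRing R] (p : ℕ) (hp : p ≠ 0) (f g : R⟦X⟧)
    (n : ℕ) :
    coeff (p * n) (f * expand p hp g) =
      coeff n ((PowerSeries.mk fun k => coeff (p * k) f) * g) := by
  rw [coeff_mul, coeff_mul]
  symm
  refine Finset.sum_of_injOn (fun q => (p * q.1, p * q.2)) ?_ ?_ ?_ ?_
  · intro a _ b _ h
    simpa [hp, Prod.ext_iff] using h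
  · intro a ha
    simp only [Finset.mem_coe, Finset.HasAntidiagonal.mem_antidiagonal] at ha ⊢
    rw [← ha, mul_add]
  · intro a ha hna
    rw [coeff_expand_of_not_dvd, mul_zero]
    rintro ⟨b, hb⟩
    rw [Finset.HasAntidiagonal.mem_antidiagonal] at ha
    obtain ⟨c, hc⟩ : p ∣ a.1 := by
      rw [← Nat.dvd_add_left ⟨b, hb⟩, ha]
      exact dvd_mul_right _ _
    refine hna ⟨(c, b), ?_, Prod.ext hc.symm hb.symm⟩
    simp only [Finset.mem_coe, Finset.HasAntidiagonal.mem_antidiagonal]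
    rw [hc, hb, ← mul_add] at ha
    exact Nat.eq_of_mul_eq_mul_left (Nat.pos_of_ne_zero hp) ha
  · intro a _
    simp

theorem thetaSeries_pow_three (e : ℕ) (s : ZMod 3) :
    thetaSeries e s ^ 3 = thetaSeries (3 * e) s := by
  have : Fact (Nat.Prime 3) := ⟨Nat.prime_three⟩
  have h := MvPowerSeries.map_frobenius_expand (σ := Unit) 3 three_ne_zero (f := thetaSeries e s)
  rw [ZMod.frobenius_zmod, MvPowerSeries.map_id] at h
  exact h.symm.trans (expand_thetaSeries three_ne_zero e s)

/-- A zero of `x ^ 2 + 2 * y ^ 2 + 2 * z ^ 2` modulo `3` lies on exactly one of the four isotropic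
lines, unless it is the origin, which lies on all four. -/
theorem sum_isotropic_lines_eq (s x y z : ZMod 3) (h : x ^ 2 + 2 * y ^ 2 + 2 * z ^ 2 = 0) :
    (if x = y ∧ z = 0 then s else 0) + (if x = -y ∧ z = 0 then s else 0) +
      (if x = z ∧ y = 0 then s else 0) + (if x = -z ∧ y = 0 then s else 0) = s := by
  revert s x y z
  decide

theorem coeff_three_mul_ternary (n : ℕ) :
    coeff (3 * n) (thetaSeries 1 (1 : ZMod 3) * thetaSeries 2 (-1) * thetaSeries 2 (-1)) =
      coeff n (thetaSeries 1 (-1 : ZMod 3) * thetaSeries 2 (-1) * thetaSeries 6 (-1)) := by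
  have f1 := finite_fibre_mul_natAbs_sq one_ne_zero
  have f2 := finite_fibre_mul_natAbs_sq two_ne_zero
  have f6 := finite_fibre_mul_natAbs_sq (e := 6) (by norm_num)
  simp only [thetaSeries, weightSeries_mul f1 f2, weightSeries_mul (finite_fibre_add f1 f2) f2,
    weightSeries_mul (finite_fibre_add f1 f2) f6]
  rw [coeff_weightSeries (finite_fibre_add (finite_fibre_add f1 f2) f2),
    coeff_weightSeries (finite_fibre_add (finite_fibre_add f1 f2) f6)]
  set T := (finite_fibre_add (finite_fibre_add f1 f2) f2 (3 * n)).toFinset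
  set U := (finite_fibre_add (finite_fibre_add f1 f2) f6 n).toFinset
  have memT : ∀ v : (ℤ × ℤ) × ℤ, v ∈ T ↔ v.1.1 ^ 2 + 2 * v.1.2 ^ 2 + 2 * v.2 ^ 2 = 3 * n := by
    intro v
    simp only [T, Set.Finite.mem_toFinset, Set.mem_ofPred_eq]
    zify
    simp only [sq_abs, one_mul]
  have memU : ∀ v : (ℤ × ℤ) × ℤ, v ∈ U ↔ v.1.1 ^ 2 + 2 * v.1.2 ^ 2 + 6 * v.2 ^ 2 = n := by
    intro v
    simp only [U, Set.Finite.mem_toFinset, Set.mem_ofPred_eq]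
    zify
    simp only [sq_abs, one_mul]
  simp only [one_pow, one_mul, ← pow_add]
  have hsplit : ∀ v ∈ T, (-1 : ZMod 3) ^ (v.1.2.natAbs ^ 2 + v.2.natAbs ^ 2) =
      (if (3 : ℤ) ∣ v.1.1 - v.1.2 ∧ (3 : ℤ) ∣ v.2 then
        (-1 : ZMod 3) ^ (v.1.2.natAbs ^ 2 + v.2.natAbs ^ 2) else 0) +
      (if (3 : ℤ) ∣ v.1.1 + v.1.2 ∧ (3 : ℤ) ∣ v.2 then
        (-1 : ZMod 3) ^ (v.1.2.natAbs ^ 2 + v.2.natAbs ^ 2) else 0) +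
      (if (3 : ℤ) ∣ v.1.1 - v.2 ∧ (3 : ℤ) ∣ v.1.2 then
        (-1 : ZMod 3) ^ (v.1.2.natAbs ^ 2 + v.2.natAbs ^ 2) else 0) +
      (if (3 : ℤ) ∣ v.1.1 + v.2 ∧ (3 : ℤ) ∣ v.1.2 then
        (-1 : ZMod 3) ^ (v.1.2.natAbs ^ 2 + v.2.natAbs ^ 2) else 0) := by
    intro v hv
    have hdvd : ∀ a : ℤ, (3 : ℤ) ∣ a ↔ (a : ZMod 3) = 0 := fun a =>
      (ZMod.intCast_zmod_eq_zero_iff_dvd a 3).symm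
    have hmod := congrArg (Int.cast : ℤ → ZMod 3) ((memT v).mp hv)
    have h3 : (3 : ZMod 3) = 0 := by decide
    push_cast at hmod
    rw [h3, zero_mul] at hmod
    simp only [hdvd, Int.cast_sub, Int.cast_add, sub_eq_zero, add_eq_zero_iff_eq_neg]
    exact (sum_isotropic_lines_eq _ _ _ _ hmod).symm
  have hline : ∀ ε : ℤ, ε = 1 ∨ ε = -1 →
      ∑ v ∈ T with (3 : ℤ) ∣ v.1.1 - ε * v.1.2 ∧ (3 : ℤ) ∣ v.2,
        (-1 : ZMod 3) ^ (v.1.2.natAbs ^ 2 + v.2.natAbs ^ 2) =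
      ∑ v ∈ U, (-1 : ZMod 3) ^ (v.1.1.natAbs ^ 2 + v.1.2.natAbs ^ 2 + v.2.natAbs ^ 2) := by
    intro ε hε
    have hε2 : ε ^ 2 = 1 := by rcases hε with rfl | rfl <;> norm_num
    refine Finset.sum_nbij'
      (fun v => (((v.1.1 + 2 * (ε * v.1.2)) / 3, (v.1.1 - ε * v.1.2) / 3), v.2 / 3))
      (fun v => ((v.1.1 + 2 * v.1.2, ε * (v.1.1 - v.1.2)), 3 * v.2)) ?_ ?_ ?_ ?_ ?_
    · rintro ⟨⟨x, y⟩, z⟩ hv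
      simp only [Finset.mem_filter, memT, memU] at hv ⊢
      obtain ⟨h, ⟨t, ht⟩, s, rfl⟩ := hv
      have hx : x = ε * y + 3 * t := by linear_combination ht
      have hu : (x + 2 * (ε * y)) / 3 = ε * y + t := by lia
      have ht' : (x - ε * y) / 3 = t := by lia
      rw [hu, ht', Int.mul_ediv_cancel_left _ three_ne_zero]
      subst hx
      linarith [show (3 : ℤ) * ((ε * y + t) ^ 2 + 2 * t ^ 2 + 6 * s ^ 2) = 3 * n by
        linear_combination h + 2 * y ^ 2 * hε2]
    · rintro ⟨⟨u, t⟩, s⟩ hv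
      simp only [Finset.mem_filter, memT, memU] at hv ⊢
      refine ⟨?_, ⟨t, ?_⟩, dvd_mul_right _ _⟩
      · linear_combination 3 * hv + 2 * (u - t) ^ 2 * hε2
      · linear_combination -(u - t) * hε2
    · rintro ⟨⟨x, y⟩, z⟩ hv
      simp only [Finset.mem_filter] at hv
      obtain ⟨-, ⟨t, ht⟩, s, rfl⟩ := hv
      have hu : (x + 2 * (ε * y)) / 3 = ε * y + t := by lia
      have ht' : (x - ε * y) / 3 = t := by lia
      simp only [hu, ht', Prod.mk.injEq]
      exact ⟨⟨by lia, by linear_combination y * hε2⟩, by lia⟩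
    · rintro ⟨⟨u, t⟩, s⟩ -
      have h : ε * (ε * (u - t)) = u - t := by linear_combination (u - t) * hε2
      simp only [h, Prod.mk.injEq]
      lia
    · rintro ⟨⟨x, y⟩, z⟩ hv
      simp only [Finset.mem_filter] at hv
      obtain ⟨-, ⟨t, ht⟩, s, rfl⟩ := hv
      have hu : (x + 2 * (ε * y)) / 3 = ε * y + t := by lia
      have ht' : (x - ε * y) / 3 = t := by lia
      simp only [hu, ht', Int.mul_ediv_cancel_left _ (three_ne_zero (α := ℤ))]
      refine neg_one_pow_congr ?_
      rcases hε with rfl | rfl <;> simp [parity_simps] <;> tauto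
  have hswap : ∀ ε : ℤ,
      ∑ v ∈ T with (3 : ℤ) ∣ v.1.1 - ε * v.2 ∧ (3 : ℤ) ∣ v.1.2,
        (-1 : ZMod 3) ^ (v.1.2.natAbs ^ 2 + v.2.natAbs ^ 2) =
      ∑ v ∈ T with (3 : ℤ) ∣ v.1.1 - ε * v.1.2 ∧ (3 : ℤ) ∣ v.2,
        (-1 : ZMod 3) ^ (v.1.2.natAbs ^ 2 + v.2.natAbs ^ 2) := by
    intro ε
    refine Finset.sum_nbij' (fun v => ((v.1.1, v.2), v.1.2)) (fun v => ((v.1.1, v.2), v.1.2))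
      ?_ ?_ (fun _ _ => rfl) (fun _ _ => rfl) (fun v _ => by rw [add_comm]) <;>
    · intro v hv
      simp only [Finset.mem_filter, memT] at hv ⊢
      exact ⟨by linarith [hv.1], hv.2⟩
  have p1 := hline 1 (Or.inl rfl)
  have m1 := hline (-1) (Or.inr rfl)
  have p2 := (hswap 1).trans p1
  have m2 := (hswap (-1)).trans m1
  simp only [one_mul, neg_mul, sub_neg_eq_add] at p1 m1 p2 m2
  rw [Finset.sum_congr rfl hsplit]
  simp only [Finset.sum_add_distrib, ← Finset.sum_filter]
  rw [p1, m1, p2, m2]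
  have h3 : (3 : ZMod 3) = 0 := by decide
  linear_combination (∑ v ∈ U,
    (-1 : ZMod 3) ^ (v.1.1.natAbs ^ 2 + v.1.2.natAbs ^ 2 + v.2.natAbs ^ 2)) * h3

theorem mk_pbarOdd_three_mul :
    (PowerSeries.mk fun n => (pbarOdd (3 * n) : ZMod 3)) =
      thetaSeries 1 (-1) * thetaSeries 6 (-1) := by
  have : Fact (Nat.Prime 3) := ⟨Nat.prime_three⟩
  refine mul_right_cancel₀ (thetaSeries_ne_zero two_ne_zero (-1 : ZMod 3)) ?_
  have hcube : (PowerSeries.mk fun n => (pbarOdd n : ZMod 3)) *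
      expand 3 three_ne_zero (thetaSeries 2 (-1)) =
      thetaSeries 1 1 * thetaSeries 2 (-1) * thetaSeries 2 (-1) := by
    rw [expand_thetaSeries, ← thetaSeries_pow_three, ← mk_pbarOdd_mul_thetaSeries]
    ring
  ext n
  rw [mul_right_comm, ← coeff_three_mul_ternary, ← hcube, coeff_mul_mul_expand]
  simp

theorem sq_add_six_mul_sq_ne (α k : ℕ) (x y : ℤ) :
    x ^ 2 + 6 * y ^ 2 ≠ 4 ^ α * (8 * k + 5) := by
  induction α generalizing x y with
  | zero =>
    intro h
    have h8 := congrArg (Int.cast : ℤ → ZMod 8) h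
    push_cast at h8
    rw [show (8 : ZMod 8) = 0 by decide] at h8
    simp only [one_mul, zero_mul, zero_add] at h8
    generalize (x : ZMod 8) = a at h8
    generalize (y : ZMod 8) = b at h8
    revert a b
    decide
  | succ α ih =>
    intro h
    have hx : Even x := by
      have : Even (x ^ 2) := by
        rw [show x ^ 2 = 2 * (2 * 4 ^ α * (8 * k + 5) - 3 * y ^ 2) by linear_combination h]
        exact even_two_mul _
      exact (Int.even_pow.mp this).1
    obtain ⟨a, rfl⟩ := hx
    have hy : Even y := by
      have : Even (3 * y ^ 2) := by
        rw [show 3 * y ^ 2 = 2 * (4 ^ α * (8 * k + 5) - a ^ 2) by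
          linarith [show 2 * (3 * y ^ 2) = 2 * (2 * (4 ^ α * (8 * (k : ℤ) + 5) - a ^ 2)) by
            linear_combination h]]
        exact even_two_mul _
      rcases Int.even_mul.mp this with h3 | h3
      · exact absurd h3 (by decide)
      · exact (Int.even_pow.mp h3).1
    obtain ⟨b, rfl⟩ := hy
    refine ih a b ?_
    linarith [show 4 * (a ^ 2 + 6 * b ^ 2) = 4 * (4 ^ α * (8 * (k : ℤ) + 5)) by
      linear_combination h]

end ModThree

theorem pbarOdd_cong_24_15 (n α : ℕ) :
    pbarOdd (2 ^ (2 * α) * (24 * n + 15)) ≡ 0 [MOD 3] := by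
  rw [← ZMod.natCast_eq_natCast_iff, Nat.cast_zero,
    show 2 ^ (2 * α) * (24 * n + 15) = 3 * (4 ^ α * (8 * n + 5)) by rw [pow_mul]; ring]
  have h := congrArg (PowerSeries.coeff (4 ^ α * (8 * n + 5))) mk_pbarOdd_three_mul
  have f1 := finite_fibre_mul_natAbs_sq one_ne_zero
  have f6 := finite_fibre_mul_natAbs_sq (e := 6) (by norm_num)
  rw [PowerSeries.coeff_mk, thetaSeries, thetaSeries, weightSeries_mul f1 f6,
    coeff_weightSeries (finite_fibre_add f1 f6)] at h
  rw [h]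
  refine Finset.sum_eq_zero fun v hv => absurd ?_ (sq_add_six_mul_sq_ne α n v.1 v.2)
  simp only [Set.Finite.mem_toFinset, Set.mem_ofPred_eq] at hv
  zify at hv
  simpa only [sq_abs, one_mul] using hv
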